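/- Let 𝔤 be a finite-dimensional semisimple Lie algebra over an algebraically closed field K of characteristic 0, let 𝔥 ⊆ 𝔤 be a Cartan subalgebra, let Φ be the associated set of roots (the nonzero weights of the adjoint action of 𝔥 on 𝔤), and for α ∈ Φ let 𝔤_α denote the corresponding root space. Let Φ' ⊆ Φ be a subset with the property that every element of Φ is a finite sum of elements of Φ' (repetitions allowed). Then 𝔤 is generated as a Lie algebra by the subset ⊕_{α ∈ Φ'} 𝔤_α. -/

import Mathlib

open LieAlgebra LieAlgebra.IsKilling LieModule in
/-- A subalgebra containing the root spaces of `β`, `γ` contains that of the root `β + γ`. -/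
theorem aux_add {K L : Type} [Field K] [CharZero K] [LieRing L] [LieAlgebra K L]
    [IsKilling K L] [FiniteDimensional K L]
    {H : LieSubalgebra K L} [H.IsCartanSubalgebra] [IsTriangularizable K H L]
    (S : LieSubalgebra K L) (β γ δ : Weight K H L) (hβ : β.IsNonZero) (hδ : δ.IsNonZero)
    (h : (δ : H → K) = β + γ)
    (hβS : ∀ x ∈ rootSpace H β, x ∈ S) (hγS : ∀ x ∈ rootSpace H γ, x ∈ S) :
    ∀ x ∈ rootSpace H δ, x ∈ S := by
  have h1 : 1 ≤ chainTopCoeff β γ := by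
    have := ((rootSpace_zsmul_add_ne_bot_iff β γ hβ 1).mp
      (by rw [one_smul, ← h]; exact δ.2)).1
    exact_mod_cast this
  have h2 : chainTopCoeff β γ ≤ chainLength β γ := chainTopCoeff_le_chainLength β γ
  obtain ⟨k, hk⟩ := Nat.exists_eq_add_of_le' h1
  obtain ⟨v, hv, hv0⟩ := (chainTop β γ).exists_ne_zero
  obtain ⟨h', e, f, isSl2, he, hf⟩ := exists_isSl2Triple_of_weight_isNonZero hβ
  obtain rfl := isSl2.h_eq_coroot hβ he hf
  have prim : isSl2.HasPrimitiveVectorWith v (chainLength β γ : K) :=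
    have := lie_mem_genWeightSpace_of_mem_genWeightSpace he hv
    ⟨hv0, (chainLength_smul _ _ hv).symm, by rwa [genWeightSpace_add_chainTop _ _ hβ] at this⟩
  have hy := toEnd_pow_apply_mem hf hv (k + 1)
  have hz := toEnd_pow_apply_mem hf hv k
  have hz0 := prim.pow_toEnd_f_ne_zero_of_eq_nat rfl (i := k) (by omega)
  have hyz := prim.lie_e_pow_succ_toEnd_f k
  have e1 : (k + 1) • (-(β : H → K)) + (chainTop β γ : H → K) = γ := by
    rw [coe_chainTop', hk, smul_neg, neg_add_cancel_left]
  have e2 : k • (-(β : H → K)) + (chainTop β γ : H → K) = δ := by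
    rw [coe_chainTop', hk, h, smul_neg, succ_nsmul]; abel
  rw [e1] at hy
  rw [e2] at hz
  have hc : (((k : K) + 1) * ((chainLength β γ : K) - k)) ≠ 0 := by
    refine mul_ne_zero (Nat.cast_add_one_ne_zero k) (sub_ne_zero.mpr ?_)
    exact_mod_cast (by omega : chainLength β γ ≠ k)
  intro x hx
  obtain ⟨c, hcx⟩ := (finrank_eq_one_iff_of_nonzero' (⟨_, hz⟩ : rootSpace H δ)
    (by simpa using hz0)).mp (finrank_rootSpace_eq_one δ hδ) ⟨x, hx⟩
  have hcx' := congrArg Subtype.val hcx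
  have hzS : ((toEnd K L L f) ^ k) v ∈ S := by
    have := S.lie_mem (hβS _ he) (hγS _ hy)
    rw [hyz] at this
    have h3 := S.smul_mem (((k : K) + 1) * ((chainLength β γ : K) - k))⁻¹ this
    rwa [smul_smul, inv_mul_cancel₀ hc, one_smul] at h3
  rw [← show c • ((toEnd K L L f) ^ k) v = x from hcx']
  exact S.smul_mem _ hzS

open LieAlgebra LieAlgebra.IsKilling LieModule in
/-- If a nonzero root `α` is a sum of roots whose root spaces lie in `S`, so does its own. -/
theorem aux_sum {K L : Type} [Field K] [CharZero K] [LieRing L] [LieAlgebra K L]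
    [IsKilling K L] [FiniteDimensional K L]
    {H : LieSubalgebra K L} [H.IsCartanSubalgebra] [IsTriangularizable K H L]
    (S : LieSubalgebra K L) (n : ℕ) : ∀ (l : List (H → K)), l.length = n →
      (∀ β ∈ l, β ≠ 0 ∧ rootSpace H β ≠ ⊥ ∧ ∀ x ∈ rootSpace H β, x ∈ S) →
      ∀ α : Weight K H L, α.IsNonZero → (α : H → K) = l.sum →
      ∀ x ∈ rootSpace H α, x ∈ S := by
  classical
  induction n with
  | zero =>
    intro l hl _ α hα hs
    rw [List.length_eq_zero_iff] at hl
    subst hl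
    exact absurd hs hα
  | succ n ih =>
    intro l hl hS α hα hs
    -- some member pairs positively with the coroot of `α`
    have key : ∃ β ∈ l, ∃ (β' : Weight K H L), (β' : H → K) = β ∧
        0 < (chainBotCoeff α β' : ℤ) - chainTopCoeff α β' := by
      by_contra hcon
      push Not at hcon
      have gen : ∀ m : List (H → K), (∀ β ∈ m, β ∈ l) →
          ∃ z : ℤ, z ≤ 0 ∧ m.sum (coroot α) = (z : K) := by
        intro m
        induction m with
        | nil => intro _; exact ⟨0, le_rfl, by simp⟩
        | cons b m ihm =>
          intro hm
          obtain ⟨z, hz, hz'⟩ := ihm fun β hβ => hm β (List.mem_cons_of_mem _ hβ)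
          have hb := hm b List.mem_cons_self
          let b' : Weight K H L := ⟨b, (hS b hb).2.1⟩
          have h1 := hcon b hb b' rfl
          have h2 : b (coroot α) = _ := apply_coroot_eq_cast α b'
          refine ⟨_, add_nonpos h1 hz, ?_⟩
          rw [List.sum_cons, Pi.add_apply, h2, hz', Int.cast_add]
      obtain ⟨z, hz, hz'⟩ := gen l fun _ h => h
      rw [← hs, root_apply_coroot hα] at hz'
      have : (2 : ℤ) = z := by exact_mod_cast hz'
      omega
    obtain ⟨β, hβl, β, rfl, hpos⟩ := key
    obtain ⟨hβ0, -, hβS⟩ := hS _ hβl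
    have hne : rootSpace H ((-1 : ℤ) • (α : H → K) + β) ≠ ⊥ :=
      (rootSpace_zsmul_add_ne_bot_iff α β hα (-1)).mpr ⟨by omega, by omega⟩
    let γ : Weight K H L := -⟨_, hne⟩
    have hγ : (γ : H → K) = α - β := by
      change -((-1 : ℤ) • (α : H → K) + β) = _
      rw [neg_smul, one_smul]; abel
    by_cases hγ0 : γ.IsZero
    · have : (α : H → K) = β := by
        rw [← sub_eq_zero, ← hγ]; exact hγ0
      rw [this]; exact hβS
    · have hlen : (l.erase (β : H → K)).length = n := by
        rw [List.length_erase_of_mem hβl, hl]; rfl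
      have hsum : (γ : H → K) = (l.erase (β : H → K)).sum := by
        rw [hγ, hs, ← List.sum_erase hβl]; abel
      have hγS := ih _ hlen (fun b hb => hS b (List.mem_of_mem_erase hb)) γ hγ0 hsum
      exact aux_add S β γ α hβ0 hα (by rw [hγ]; abel) hβS hγS

/-- If `Φ' ⊆ Φ` is a set of roots of a finite-dimensional semisimple Lie algebra over an
algebraically closed field of characteristic 0 (with respect to a Cartan subalgebra `H`)
such that every root is a finite sum of elements of `Φ'`, then the root spaces `𝔤_α` for
`α ∈ Φ'` generate `𝔤` as a Lie algebra. -/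
theorem stmt_18 {K : Type} [Field K] [IsAlgClosed K] [CharZero K]
    {L : Type} [LieRing L] [LieAlgebra K L] [Module.Finite K L]
    [LieAlgebra.IsSemisimple K L]
    (H : LieSubalgebra K L) [H.IsCartanSubalgebra]
    (Φ' : Set (↥H → K))
    (hΦ'sub : ∀ β ∈ Φ', β ≠ 0 ∧ LieAlgebra.rootSpace H β ≠ ⊥)
    (hgen : ∀ α : ↥H → K, α ≠ 0 → LieAlgebra.rootSpace H α ≠ ⊥ →
      ∃ l : List (↥H → K), l ≠ [] ∧ (∀ β ∈ l, β ∈ Φ') ∧ α = l.sum) :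
    LieSubalgebra.lieSpan K L (⋃ β ∈ Φ', (LieAlgebra.rootSpace H β : Set L)) = ⊤ := by
  haveI : LieAlgebra.IsKilling K L := inferInstance
  set S := LieSubalgebra.lieSpan K L (⋃ β ∈ Φ', (LieAlgebra.rootSpace H β : Set L)) with hSdef
  have hroot : ∀ α : LieModule.Weight K H L, α.IsNonZero →
      ∀ x ∈ LieAlgebra.rootSpace H α, x ∈ S := by
    intro α hα
    obtain ⟨l, -, hl, hs⟩ := hgen α hα α.2
    refine aux_sum S _ l rfl (fun β hβ => ⟨(hΦ'sub β (hl β hβ)).1, (hΦ'sub β (hl β hβ)).2, ?_⟩)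
      α hα hs
    intro x hx
    exact LieSubalgebra.subset_lieSpan (Set.mem_biUnion (hl β hβ) hx)
  have hcar : ∀ α : LieModule.Weight K H L, α.IsNonZero →
      (LieAlgebra.IsKilling.corootSubmodule α).toSubmodule ≤ S.toSubmodule := by
    intro α hα x hx
    obtain ⟨y, hy, rfl⟩ := (LieSubmodule.mem_map _).mp hx
    have hy' := (LieAlgebra.mem_corootSpace _).mp hy
    refine Submodule.span_le.mpr ?_ hy'
    rintro _ ⟨u, hu, w, hw, rfl⟩
    exact S.lie_mem (hroot α hα u hu) (hroot (-α) hα.neg w hw)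
  have htop := LieAlgebra.cartan_sup_iSup_rootSpace_eq_top (K := K) (L := L) (H := H)
  rw [← LieAlgebra.IsKilling.biSup_corootSubmodule_eq_cartan] at htop
  have htop' := congrArg LieSubmodule.toSubmodule htop
  simp only [LieSubmodule.sup_toSubmodule, LieSubmodule.iSup_toSubmodule,
    LieSubmodule.top_toSubmodule] at htop'
  rw [← LieSubalgebra.toSubmodule_inj, LieSubalgebra.top_toSubmodule, eq_top_iff, ← htop']
  exact sup_le (iSup₂_le hcar) (iSup₂_le hroot)
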